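/- arXiv:1610.05865 — 2 statements merged into one kernel-verified Lean document; each statement's English description precedes it below -/
import Mathlib

section
/- Let f : ℍ → ℂ be defined by f(τ) = −(1/462)·( E₆(τ)·(DE₄)(τ)/(240·η(τ)²²) − η(τ)² ), where (DE₄)(τ) = 240∑_{n≥1} n·σ₃(n)qⁿ. Then f is holomorphic on ℍ and satisfies the second-order modular linear differential equation D²f − (1/6)·E₂·Df − (143/144)·E₄·f = 0 on ℍ (this is the MLDE of weight 0 with parameter h = 12, since (h−1)(h+1)/144 = 143/144). (In the paper, f is the normalized character of the simple affine vertex algebra V_{−3}(E₆).) -/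
noncomputable section

open Complex

/-- `q = exp(2πiτ)`. -/
def qc (τ : ℂ) : ℂ := Complex.exp (2 * (Real.pi : ℂ) * Complex.I * τ)

/-- `σ_k(n) = ∑_{d ∣ n} d^k`, as a complex number. -/
def sigmaC (k n : ℕ) : ℂ := ∑ d ∈ n.divisors, (d : ℂ) ^ k

/-- Eisenstein series `E₂(τ) = 1 - 24 ∑_{n≥1} σ₁(n) qⁿ`. -/
def E2 (τ : ℂ) : ℂ := 1 - 24 * ∑' n : ℕ, sigmaC 1 (n + 1) * qc τ ^ (n + 1)

/-- Eisenstein series `E₄(τ) = 1 + 240 ∑_{n≥1} σ₃(n) qⁿ`. -/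
def E4 (τ : ℂ) : ℂ := 1 + 240 * ∑' n : ℕ, sigmaC 3 (n + 1) * qc τ ^ (n + 1)

/-- Eisenstein series `E₆(τ) = 1 - 504 ∑_{n≥1} σ₅(n) qⁿ`. -/
def E6 (τ : ℂ) : ℂ := 1 - 504 * ∑' n : ℕ, sigmaC 5 (n + 1) * qc τ ^ (n + 1)

/-- The normalized derivative of `E₄`: `(DE₄)(τ) = 240 ∑_{n≥1} n σ₃(n) qⁿ`. -/
def DE4 (τ : ℂ) : ℂ := 240 * ∑' n : ℕ, ((n : ℂ) + 1) * sigmaC 3 (n + 1) * qc τ ^ (n + 1)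

/-- Dedekind eta function `η(τ) = exp(2πiτ/24) ∏_{n≥1} (1 - qⁿ)`. -/
def dedekindEta (τ : ℂ) : ℂ :=
  Complex.exp (2 * (Real.pi : ℂ) * Complex.I * τ / 24) * ∏' n : ℕ, (1 - qc τ ^ (n + 1))

/-- Normalized derivative `D = (2πi)⁻¹ d/dτ`. -/
def Dop (f : ℂ → ℂ) : ℂ → ℂ := fun τ => (2 * (Real.pi : ℂ) * Complex.I)⁻¹ * deriv f τ

/-- The upper half-plane, as a subset of `ℂ`. -/
def UHP : Set ℂ := {τ : ℂ | 0 < τ.im}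

/-- The normalized character of `V_{-3}(E₆)`:
`f(τ) = -(1/462) (E₆(τ) (DE₄)(τ) / (240 η(τ)²²) - η(τ)²)`. -/
def charE6 (τ : ℂ) : ℂ :=
  -(1 / 462) * (E6 τ * DE4 τ / (240 * dedekindEta τ ^ 22) - dedekindEta τ ^ 2)


lemma bern_four : bernoulli 4 = -1 / 30 := by
  rw [bernoulli_eq_bernoulli'_of_ne_one (by norm_num), bernoulli'_four]
lemma bern_six : bernoulli 6 = 1 / 42 := by
  have h5 : bernoulli' 5 = 0 := by
    rw [bernoulli'_def]
    norm_num [Finset.sum_range_succ, Nat.choose, bernoulli'_zero, bernoulli'_one, bernoulli'_two, bernoulli'_three, bernoulli'_four]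
  rw [bernoulli_eq_bernoulli'_of_ne_one (by norm_num), bernoulli'_def]
  norm_num [Finset.sum_range_succ, Nat.choose, h5, bernoulli'_zero, bernoulli'_one, bernoulli'_two, bernoulli'_three, bernoulli'_four]

open UpperHalfPlane Filter Topology Manifold MatrixGroups ModularForm in
/-- Level one, weight `< 12`, holomorphic and vanishing at infinity implies zero. -/
lemma levelOne_vanish (k : ℤ) (hk : k < 12) (F : ℍ → ℂ) (hF : MDiff F)
    (hs : ∀ γ : SL(2, ℤ), F ∣[k] γ = F) (h0 : Tendsto F atImInfty (𝓝 0)) : ∀ z, F z = 0 := by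
  let f : CuspForm 𝒮ℒ k :=
    { toFun := F
      slash_action_eq' := fun _ ⟨γ, hγ⟩ ↦ hγ ▸ hs γ
      holo' := hF
      zero_at_cusps' := by
        intro c hc
        rw [Subgroup.IsArithmetic.isCusp_iff_isCusp_SL2Z] at hc
        rw [OnePoint.isZeroAt_iff_forall_SL2Z hc]
        intro γ _
        rw [hs γ]
        exact h0 }
  have : f = 0 := rank_zero_iff_forall_zero.mp (CuspForm.rank_eq_zero_of_weight_lt_twelve hk) f
  intro z
  exact congrArg (fun g : CuspForm 𝒮ℒ k => g z) this

lemma norm_qc (τ : ℂ) : ‖qc τ‖ = Real.exp (-2 * Real.pi * τ.im) := by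
  simp [qc, Complex.norm_exp]

lemma norm_qc_lt_one {τ : ℂ} (h : 0 < τ.im) : ‖qc τ‖ < 1 := by
  rw [norm_qc, Real.exp_lt_one_iff]
  have := Real.pi_pos
  nlinarith

lemma hasDerivAt_qc_pow (τ : ℂ) (m : ℕ) :
    HasDerivAt (fun z => qc z ^ m) (2 * (Real.pi : ℂ) * Complex.I * (m * qc τ ^ m)) τ := by
  have h1 : HasDerivAt qc (qc τ * (2 * (Real.pi : ℂ) * Complex.I)) τ := by
    have := ((hasDerivAt_id τ).const_mul (2 * (Real.pi : ℂ) * Complex.I)).cexp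
    show HasDerivAt (fun z => Complex.exp (2 * (Real.pi : ℂ) * Complex.I * z)) _ τ
    simpa [qc] using this
  have h2 := h1.fun_pow m
  refine h2.congr_deriv ?_
  rcases m with _ | m
  · simp
  · simp only [Nat.add_sub_cancel, pow_succ]; ring

open Filter Topology in
/-- Termwise differentiation of q-series. -/
lemma qseries_deriv (c : ℕ → ℂ) (hc : ∀ τ : ℂ, 0 < τ.im → Summable fun m => c m * qc τ ^ m)
    (τ : ℂ) (hτ : 0 < τ.im) :
    HasSum (fun m : ℕ => ((m : ℂ) * c m) * qc τ ^ m) (Dop (fun z => ∑' m, c m * qc z ^ m) τ) ∧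
      DifferentiableAt ℂ (fun z => ∑' m, c m * qc z ^ m) τ := by
  set U : Set ℂ := {z | τ.im / 2 < z.im}
  have hU : IsOpen U := isOpen_lt continuous_const Complex.continuous_im
  have hτU : τ ∈ U := by change τ.im / 2 < τ.im; linarith
  have hu := (hc (Complex.I * (τ.im / 2 : ℝ)) (by simpa using hτ)).norm
  have hle : ∀ (i : ℕ) (w : ℂ), w ∈ U →
      ‖c i * qc w ^ i‖ ≤ ‖c i * qc (Complex.I * (τ.im / 2 : ℝ)) ^ i‖ := by
    intro i w hw
    simp only [norm_mul, norm_pow, norm_qc]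
    have hw' : τ.im / 2 < w.im := hw
    have hp := Real.pi_pos
    gcongr _ * Real.exp ?_ ^ i
    simp
    nlinarith
  have hd : ∀ i : ℕ, DifferentiableOn ℂ (fun w => c i * qc w ^ i) U := fun i w _ =>
    ((hasDerivAt_qc_pow w i).const_mul (c i)).differentiableAt.differentiableWithinAt
  constructor
  · have := (Complex.hasSum_deriv_of_summable_norm hu hd hU hle hτU).mul_left
      ((2 * (Real.pi : ℂ) * Complex.I)⁻¹)
    refine this.congr_fun ?_ 
    intro m
    rw [((hasDerivAt_qc_pow τ m).const_mul (c m)).deriv]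
    have := Complex.two_pi_I_ne_zero
    field_simp
  · exact (Complex.differentiableOn_tsum_of_summable_norm hu hd hU hle).differentiableAt
      (hU.mem_nhds hτU)

open Filter Topology UpperHalfPlane in
lemma qseries_tendsto (c : ℕ → ℂ) (hc : ∀ τ : ℂ, 0 < τ.im → Summable fun m => c m * qc τ ^ m) :
    Tendsto (fun z : ℍ => ∑' m, c m * qc z ^ m) atImInfty (𝓝 (c 0)) := by
  have hu := (hc Complex.I (by simp)).norm
  have hq : Tendsto (fun z : ℍ => qc z) atImInfty (𝓝 0) := by
    have := qParam_tendsto_atImInfty (h := 1) one_pos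
    simpa [Function.Periodic.qParam, qc] using this
  have key := tendsto_tsum_of_dominated_convergence (𝓕 := atImInfty)
    (f := fun (z : ℍ) m => c m * qc z ^ m) (g := fun m => c m * 0 ^ m) hu
    (fun k => (hq.pow k).const_mul (c k)) (by
      have : ∀ᶠ z : ℍ in atImInfty, 1 ≤ z.im := by
        rw [atImInfty]
        exact tendsto_comap.eventually (eventually_ge_atTop 1)
      filter_upwards [this] with z hz k
      simp only [norm_mul, norm_pow, norm_qc]
      have hp := Real.pi_pos
      gcongr _ * Real.exp ?_ ^ k
      simp
      nlinarith)
  rw [tsum_eq_single 0 (by intro b hb; simp [hb])] at key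
  simpa using key

/-- coefficients of `1 + a ∑ σ_k(n) qⁿ` -/
def eisCoeff (a : ℂ) (k m : ℕ) : ℂ := if m = 0 then 1 else a * sigmaC k m

lemma norm_sigmaC_le (k m : ℕ) : ‖sigmaC k m‖ ≤ (m : ℝ) ^ (k + 1) := by
  have h : sigmaC k m = ((ArithmeticFunction.sigma k m : ℕ) : ℂ) := by
    simp [sigmaC, ArithmeticFunction.sigma_apply]
  rw [h, Complex.norm_natCast]
  exact_mod_cast ArithmeticFunction.sigma_le_pow_succ k m

lemma summable_sigmaC (k : ℕ) (τ : ℂ) (h : 0 < τ.im) :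
    Summable fun m => sigmaC k m * qc τ ^ m := by
  apply Summable.of_norm_bounded
    (summable_norm_pow_mul_geometric_of_norm_lt_one (k+1) (norm_qc_lt_one h))
  intro n
  simp only [norm_mul, Complex.norm_natCast, norm_pow]
  gcongr
  exact norm_sigmaC_le k n

lemma eisCoeff_hasSum (a : ℂ) (k : ℕ) (τ : ℂ) (h : 0 < τ.im) :
    HasSum (fun m => eisCoeff a k m * qc τ ^ m)
      (1 + a * ∑' n : ℕ, sigmaC k (n + 1) * qc τ ^ (n + 1)) := by
  have hS : Summable fun n : ℕ ↦ sigmaC k (n + 1) * qc τ ^ (n + 1) :=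
    (summable_nat_add_iff 1).mpr (summable_sigmaC k τ h)
  rw [← hasSum_nat_add_iff' 1]
  simpa [eisCoeff, mul_assoc] using hS.hasSum.mul_left a

/-- The function `1 + a ∑ σ_k(n) qⁿ`. -/
def eisF (a : ℂ) (k : ℕ) (τ : ℂ) : ℂ := ∑' m, eisCoeff a k m * qc τ ^ m

lemma eisF_eq (a : ℂ) (k : ℕ) {τ : ℂ} (h : 0 < τ.im) :
    eisF a k τ = 1 + a * ∑' n : ℕ, sigmaC k (n + 1) * qc τ ^ (n + 1) :=
  (eisCoeff_hasSum a k τ h).tsum_eq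

lemma E2_eqF {τ : ℂ} (h : 0 < τ.im) : E2 τ = eisF (-24) 1 τ := by
  rw [eisF_eq _ _ h, E2]; ring
lemma E4_eqF {τ : ℂ} (h : 0 < τ.im) : E4 τ = eisF 240 3 τ := by
  rw [eisF_eq _ _ h, E4]
lemma E6_eqF {τ : ℂ} (h : 0 < τ.im) : E6 τ = eisF (-504) 5 τ := by
  rw [eisF_eq _ _ h, E6]; ring

lemma Dop_congr {f g : ℂ → ℂ} (h : ∀ τ : ℂ, 0 < τ.im → f τ = g τ) {τ : ℂ} (hτ : 0 < τ.im) :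
    Dop f τ = Dop g τ := by
  unfold Dop
  congr 1
  apply Filter.EventuallyEq.deriv_eq
  filter_upwards [(isOpen_lt continuous_const Complex.continuous_im).mem_nhds hτ] with z hz
  exact h z hz

lemma eisF_D (a : ℂ) (k : ℕ) (τ : ℂ) (h : 0 < τ.im) :
    HasSum (fun m : ℕ => ((m : ℂ) * eisCoeff a k m) * qc τ ^ m) (Dop (eisF a k) τ) ∧
      DifferentiableAt ℂ (eisF a k) τ :=
  qseries_deriv _ (fun τ h => (eisCoeff_hasSum a k τ h).summable) τ h

open Filter Topology UpperHalfPlane in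
lemma eisF_tendsto (a : ℂ) (k : ℕ) :
    Tendsto (fun z : ℍ => eisF a k z) atImInfty (𝓝 1) := by
  have := qseries_tendsto _ (fun τ h => (eisCoeff_hasSum a k τ h).summable)
  rwa [show eisCoeff a k 0 = 1 by simp [eisCoeff]] at this

open Filter Topology UpperHalfPlane in
lemma eisF_D_tendsto (a : ℂ) (k : ℕ) :
    Tendsto (fun z : ℍ => Dop (eisF a k) z) atImInfty (𝓝 0) := by
  have := qseries_tendsto (fun m => m * eisCoeff a k m) (fun τ h => (eisF_D a k τ h).1.summable)
  simp only [Nat.cast_zero, zero_mul] at this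
  refine this.congr ?_
  intro z
  exact (eisF_D a k z z.im_pos).1.tsum_eq

lemma DE4_eqF {τ : ℂ} (h : 0 < τ.im) : DE4 τ = Dop (eisF 240 3) τ := by
  have h1 := (eisF_D 240 3 τ h).1
  have h2 := (hasSum_nat_add_iff' 1).mpr h1
  simp [eisCoeff] at h2
  rw [← h2.tsum_eq, DE4, ← tsum_mul_left]
  congr 1
  ext n
  ring

lemma sigmaC_eq (k m : ℕ) : sigmaC k m = ((ArithmeticFunction.sigma k m : ℕ) : ℂ) := by
  simp [sigmaC, ArithmeticFunction.sigma_apply]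

open UpperHalfPlane in
lemma E2_bridge (z : ℍ) : EisensteinSeries.E2 z = eisF (-24) 1 z := by
  rw [eisF, ← (EisensteinSeries.hasSum_qExpansion_E2 z).tsum_eq]
  congr 1
  ext m
  simp [eisCoeff, sigmaC_eq, qc]

open UpperHalfPlane EisensteinSeries in
lemma E4_bridge (z : ℍ) : ModularForm.E₄ z = eisF 240 3 z := by
  have h := ModularForm.hasSum_qExpansion ModularForm.E₄ one_pos one_mem_strictPeriods_SL z
  rw [eisF, ← h.tsum_eq]
  congr 1
  ext m
  rw [E_qExpansion_coeff _ ⟨2, rfl⟩, bern_four]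
  simp [eisCoeff, sigmaC_eq, qc, Function.Periodic.qParam]
  norm_num

open UpperHalfPlane EisensteinSeries in
lemma E6_bridge (z : ℍ) : ModularForm.E₆ z = eisF (-504) 5 z := by
  have h := ModularForm.hasSum_qExpansion ModularForm.E₆ one_pos one_mem_strictPeriods_SL z
  rw [eisF, ← h.tsum_eq]
  congr 1
  ext m
  rw [E_qExpansion_coeff _ ⟨3, rfl⟩, bern_six]
  simp [eisCoeff, sigmaC_eq, qc, Function.Periodic.qParam]
  norm_num

lemma eta_bridge (z : ℂ) : dedekindEta z = ModularForm.eta z := by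
  simp [dedekindEta, ModularForm.eta, ModularForm.eta_q, Function.Periodic.qParam, qc]

open UpperHalfPlane in
lemma D_bridge (F : ℍ → ℂ) (g : ℂ → ℂ) (h : ∀ z : ℍ, F z = g z) (z : ℍ) :
    Derivative.normalizedDerivOfComplex F z = Dop g z := by
  rw [Derivative.normalizedDerivOfComplex, ← Dop]
  apply Dop_congr _ z.im_pos
  intro τ hτ
  simp [ofComplex_apply_of_im_pos hτ, h]

open UpperHalfPlane Filter Topology Manifold MatrixGroups ModularForm Derivative in
lemma ramanujan4 (z : ℍ) :
    Dop (eisF 240 3) z = (eisF (-24) 1 z * eisF 240 3 z - eisF (-504) 5 z) / 3 := by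
  let F : ℍ → ℂ := ModularForm.E₄
  let G : ℍ → ℂ := ModularForm.E₆
  have hF : MDiff F := ModularForm.E₄.holo'
  have hG : MDiff G := ModularForm.E₆.holo'
  have hFs : ∀ γ : SL(2, ℤ), F ∣[(4 : ℤ)] γ = F := fun γ =>
    SlashInvariantForm.slash_action_eqn ModularForm.E₄ _ ⟨γ, rfl⟩
  have hGs : ∀ γ : SL(2, ℤ), G ∣[(6 : ℤ)] γ = G := fun γ =>
    SlashInvariantForm.slash_action_eqn ModularForm.E₆ _ ⟨γ, rfl⟩
  have hval : ∀ z : ℍ, (serreDerivative (4 : ℤ) F + (1 / 3 : ℂ) • G) z =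
      Dop (eisF 240 3) z - 1 / 3 * (eisF (-24) 1 z * eisF 240 3 z) + 1 / 3 * eisF (-504) 5 z := by
    intro z
    rw [Pi.add_apply, Pi.smul_apply, serreDerivative_apply, D_bridge F _ E4_bridge, E2_bridge]
    simp only [F, G, E4_bridge, E6_bridge, smul_eq_mul]
    push_cast
    ring
  have := levelOne_vanish 6 (by norm_num) (serreDerivative (4 : ℤ) F + (1 / 3 : ℂ) • G)
    ((serreDerivative_mdifferentiable _ hF).add (hG.const_smul _))
    (fun γ => by
      rw [SlashAction.add_slash, ModularForm.SL_smul_slash, hGs γ]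
      congr 1
      exact serreDerivative_slash_invariant (k := 4) hF (hFs γ))
    (by
      have h1 := ((eisF_D_tendsto 240 3).sub (((eisF_tendsto (-24) 1).mul
        (eisF_tendsto 240 3)).const_mul (1 / 3))).add ((eisF_tendsto (-504) 5).const_mul (1 / 3))
      norm_num at h1
      refine h1.congr fun z => ?_
      rw [hval])
    z
  rw [hval] at this
  linear_combination this

open UpperHalfPlane Filter Topology Manifold MatrixGroups ModularForm Derivative in
lemma ramanujan6 (z : ℍ) :
    Dop (eisF (-504) 5) z = (eisF (-24) 1 z * eisF (-504) 5 z - eisF 240 3 z ^ 2) / 2 := by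
  let F : ℍ → ℂ := ModularForm.E₄
  let G : ℍ → ℂ := ModularForm.E₆
  have hF : MDiff F := ModularForm.E₄.holo'
  have hG : MDiff G := ModularForm.E₆.holo'
  have hFs : ∀ γ : SL(2, ℤ), F ∣[(4 : ℤ)] γ = F := fun γ =>
    SlashInvariantForm.slash_action_eqn ModularForm.E₄ _ ⟨γ, rfl⟩
  have hGs : ∀ γ : SL(2, ℤ), G ∣[(6 : ℤ)] γ = G := fun γ =>
    SlashInvariantForm.slash_action_eqn ModularForm.E₆ _ ⟨γ, rfl⟩
  have hval : ∀ z : ℍ, (serreDerivative (6 : ℤ) G + (1 / 2 : ℂ) • (F * F)) z =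
      Dop (eisF (-504) 5) z - 1 / 2 * (eisF (-24) 1 z * eisF (-504) 5 z)
        + 1 / 2 * (eisF 240 3 z * eisF 240 3 z) := by
    intro z
    rw [Pi.add_apply, Pi.smul_apply, serreDerivative_apply, D_bridge G _ E6_bridge, E2_bridge]
    simp only [F, G, E4_bridge, E6_bridge, smul_eq_mul, Pi.mul_apply]
    push_cast
    ring
  have := levelOne_vanish 8 (by norm_num) (serreDerivative (6 : ℤ) G + (1 / 2 : ℂ) • (F * F))
    ((serreDerivative_mdifferentiable _ hG).add ((hF.mul hF).const_smul _))
    (fun γ => by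
      rw [SlashAction.add_slash, ModularForm.SL_smul_slash]
      congr 1
      · exact serreDerivative_slash_invariant (k := 6) hG (hGs γ)
      · congr 1
        have := ModularForm.mul_slash_SL2 4 4 γ F F
        rw [hFs γ] at this
        exact this)
    (by
      have h1 := ((eisF_D_tendsto (-504) 5).sub (((eisF_tendsto (-24) 1).mul
        (eisF_tendsto (-504) 5)).const_mul (1 / 2))).add
        (((eisF_tendsto 240 3).mul (eisF_tendsto 240 3)).const_mul (1 / 2))
      norm_num at h1
      refine h1.congr fun z => ?_
      rw [hval])
    z
  rw [hval] at this
  linear_combination this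

open UpperHalfPlane Filter Topology Manifold MatrixGroups ModularForm Derivative in
lemma E2_slash_formula (γ : SL(2, ℤ)) (z : ℍ) :
    (EisensteinSeries.E2 ∣[(2 : ℤ)] γ) z = EisensteinSeries.E2 z +
      12 * (2 * (Real.pi : ℂ) * Complex.I)⁻¹ * ((γ 1 0 : ℤ) / denom γ z) := by
  have hp : (Real.pi : ℂ) ≠ 0 := by exact_mod_cast Real.pi_ne_zero
  have hd := denom_ne_zero γ z
  have hI := Complex.I_ne_zero
  simp only [EisensteinSeries.E2_slash_action, Pi.sub_apply, Pi.smul_apply,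
    EisensteinSeries.D2, riemannZeta_two, smul_eq_mul]
  field_simp
  linear_combination (-12 * ((γ 1 0 : ℤ) : ℂ)) * Complex.I_sq

open UpperHalfPlane Filter Topology Manifold MatrixGroups ModularForm Derivative in
lemma E2_slash_deriv (γ : SL(2, ℤ)) (z : ℍ) :
    normalizedDerivOfComplex (EisensteinSeries.E2 ∣[(2 : ℤ)] γ) z =
      normalizedDerivOfComplex EisensteinSeries.E2 z -
      12 * ((2 * (Real.pi : ℂ) * Complex.I)⁻¹) ^ 2 * ((γ 1 0 : ℤ) / denom γ z) ^ 2 := by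
  set a : ℂ := (2 * (Real.pi : ℂ) * Complex.I)⁻¹ with ha
  have h1 : DifferentiableAt ℂ (EisensteinSeries.E2 ∘ ofComplex) z :=
    mdifferentiableAt_iff.mp (E2_mdifferentiable z)
  have h2 := (hasDerivAt_denom_zpow (γ : GL (Fin 2) ℝ) (-1) z).const_mul (12 * a * (γ 1 0 : ℤ))
  have h3 : ((EisensteinSeries.E2 ∣[(2 : ℤ)] γ) ∘ ofComplex) =ᶠ[𝓝 ↑z] fun w =>
      (EisensteinSeries.E2 ∘ ofComplex) w + 12 * a * (γ 1 0 : ℤ) * denom γ w ^ (-1 : ℤ) := by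
    filter_upwards [isOpen_upperHalfPlaneSet.mem_nhds z.im_pos] with w hw
    simp only [Function.comp_apply, E2_slash_formula, ofComplex_apply_of_im_pos hw, zpow_neg_one,
      ← ha]
    rw [div_eq_mul_inv]
    simp only [mul_assoc]
  have hd := denom_ne_zero γ z
  rw [normalizedDerivOfComplex, ((h1.hasDerivAt.add h2).congr_of_eventuallyEq h3).deriv,
    normalizedDerivOfComplex, ← ha]
  have h5 : ((γ : GL (Fin 2) ℝ) 1 0 : ℝ) = ((γ 1 0 : ℤ) : ℝ) := by simp
  rw [h5]
  simp only [show (-1 - 1 : ℤ) = -2 by norm_num, zpow_neg]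
  push_cast
  field_simp
  ring

open UpperHalfPlane Filter Topology Manifold MatrixGroups ModularForm Derivative in
lemma E2_serre_invariant (γ : SL(2, ℤ)) :
    serreDerivative (1 : ℂ) EisensteinSeries.E2 ∣[(4 : ℤ)] γ =
      serreDerivative (1 : ℂ) EisensteinSeries.E2 := by
  set P : ℍ → ℂ := EisensteinSeries.E2 with hPdef
  have hP : MDiff P := E2_mdifferentiable
  have e0 : serreDerivative (1 : ℂ) P = normalizedDerivOfComplex P + (-(1 / 12) : ℂ) • (P * P) := by
    ext z
    simp only [serreDerivative_apply, Pi.add_apply, Pi.smul_apply, Pi.mul_apply, smul_eq_mul, hPdef]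
    ring
  have e4 := ModularForm.mul_slash_SL2 2 2 γ P P
  rw [show (2 + 2 : ℤ) = 4 by norm_num] at e4
  rw [e0, SlashAction.add_slash, ModularForm.SL_smul_slash, e4]
  ext z
  have e1 := E2_slash_formula γ z
  have e2 := congrFun (normalizedDerivOfComplex_SL_slash (k := 2) hP (γ := γ)) z
  have e3 := E2_slash_deriv γ z
  rw [show (2 + 2 : ℤ) = 4 by norm_num] at e2
  simp only [← hPdef] at e1 e3
  simp only [Pi.add_apply, Pi.smul_apply, Pi.mul_apply, smul_eq_mul, Pi.sub_apply] at e2 ⊢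
  rw [e3, e1] at e2
  rw [e1]
  push_cast at e2
  linear_combination -e2

open UpperHalfPlane Filter Topology Manifold MatrixGroups ModularForm Derivative in
lemma ramanujan2 (z : ℍ) :
    Dop (eisF (-24) 1) z = (eisF (-24) 1 z ^ 2 - eisF 240 3 z) / 12 := by
  let F : ℍ → ℂ := ModularForm.E₄
  let P : ℍ → ℂ := EisensteinSeries.E2
  have hF : MDiff F := ModularForm.E₄.holo'
  have hP : MDiff P := E2_mdifferentiable
  have hFs : ∀ γ : SL(2, ℤ), F ∣[(4 : ℤ)] γ = F := fun γ =>
    SlashInvariantForm.slash_action_eqn ModularForm.E₄ _ ⟨γ, rfl⟩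
  have hval : ∀ z : ℍ, (serreDerivative (1 : ℂ) P + (1 / 12 : ℂ) • F) z =
      Dop (eisF (-24) 1) z - 1 / 12 * (eisF (-24) 1 z * eisF (-24) 1 z)
        + 1 / 12 * eisF 240 3 z := by
    intro z
    rw [Pi.add_apply, Pi.smul_apply, serreDerivative_apply, D_bridge P _ E2_bridge, E2_bridge]
    simp only [F, P, E4_bridge, E2_bridge, smul_eq_mul]
    ring
  have := levelOne_vanish 4 (by norm_num) (serreDerivative (1 : ℂ) P + (1 / 12 : ℂ) • F)
    ((serreDerivative_mdifferentiable _ hP).add (hF.const_smul _))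
    (fun γ => by
      rw [SlashAction.add_slash, ModularForm.SL_smul_slash, hFs γ]
      congr 1
      exact E2_serre_invariant γ)
    (by
      have h1 := ((eisF_D_tendsto (-24) 1).sub (((eisF_tendsto (-24) 1).mul
        (eisF_tendsto (-24) 1)).const_mul (1 / 12))).add
        ((eisF_tendsto 240 3).const_mul (1 / 12))
      norm_num at h1
      refine h1.congr fun z => ?_
      rw [hval])
    z
  rw [hval] at this
  linear_combination this

lemma eta_ne {τ : ℂ} (h : 0 < τ.im) : dedekindEta τ ≠ 0 := by
  rw [eta_bridge]; exact ModularForm.eta_ne_zero h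

lemma hasDeriv_eta {τ : ℂ} (h : 0 < τ.im) :
    HasDerivAt dedekindEta
      (2 * (Real.pi : ℂ) * Complex.I * (eisF (-24) 1 τ * dedekindEta τ / 24)) τ := by
  have he : dedekindEta = ModularForm.eta := funext eta_bridge
  have h0 := eta_ne h
  rw [he] at h0 ⊢
  refine (ModularForm.differentiableAt_eta_of_mem_upperHalfPlaneSet h).hasDerivAt.congr_deriv ?_
  have := ModularForm.logDeriv_eta_eq_E2 ⟨τ, h⟩
  rw [E2_bridge] at this
  simp only [logDeriv_apply, UpperHalfPlane.coe_mk] at this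
  rw [div_eq_iff h0] at this
  rw [this]
  ring

lemma eta_pow {τ : ℂ} (h : 0 < τ.im) :
    dedekindEta τ ^ 24 = (eisF 240 3 τ ^ 3 - eisF (-504) 5 τ ^ 2) / 1728 := by
  have := ModularForm.discriminant_eq_E₄_cube_sub_E₆_sq ⟨τ, h⟩
  rw [E4_bridge, E6_bridge] at this
  rw [eta_bridge]
  exact this

lemma hasDeriv_of_Dop {f : ℂ → ℂ} {τ v : ℂ} (hf : DifferentiableAt ℂ f τ) (hv : Dop f τ = v) :
    HasDerivAt f (2 * (Real.pi : ℂ) * Complex.I * v) τ := by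
  refine hf.hasDerivAt.congr_deriv ?_
  rw [← hv, Dop, mul_inv_cancel_left₀ Complex.two_pi_I_ne_zero]

lemma Dop_of_hasDeriv {f : ℂ → ℂ} {τ v : ℂ}
    (hf : HasDerivAt f (2 * (Real.pi : ℂ) * Complex.I * v) τ) : Dop f τ = v := by
  rw [Dop, hf.deriv, inv_mul_cancel_left₀ Complex.two_pi_I_ne_zero]

lemma hasDeriv_P {τ : ℂ} (h : 0 < τ.im) : HasDerivAt (eisF (-24) 1)
    (2 * (Real.pi : ℂ) * Complex.I * ((eisF (-24) 1 τ ^ 2 - eisF 240 3 τ) / 12)) τ :=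
  hasDeriv_of_Dop (eisF_D _ _ τ h).2 (ramanujan2 ⟨τ, h⟩)

lemma hasDeriv_Q {τ : ℂ} (h : 0 < τ.im) : HasDerivAt (eisF 240 3)
    (2 * (Real.pi : ℂ) * Complex.I *
      ((eisF (-24) 1 τ * eisF 240 3 τ - eisF (-504) 5 τ) / 3)) τ :=
  hasDeriv_of_Dop (eisF_D _ _ τ h).2 (ramanujan4 ⟨τ, h⟩)

lemma hasDeriv_R {τ : ℂ} (h : 0 < τ.im) : HasDerivAt (eisF (-504) 5)
    (2 * (Real.pi : ℂ) * Complex.I *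
      ((eisF (-24) 1 τ * eisF (-504) 5 τ - eisF 240 3 τ ^ 2) / 2)) τ :=
  hasDeriv_of_Dop (eisF_D _ _ τ h).2 (ramanujan6 ⟨τ, h⟩)

/-- `η^{-22}` -/
def etaU (τ : ℂ) : ℂ := (dedekindEta τ ^ 22)⁻¹

lemma hasDeriv_U {τ : ℂ} (h : 0 < τ.im) : HasDerivAt etaU
    (2 * (Real.pi : ℂ) * Complex.I * (-(11 / 12) * eisF (-24) 1 τ * etaU τ)) τ := by
  have h0 := eta_ne h
  refine (((hasDeriv_eta h).fun_pow 22).fun_inv (pow_ne_zero _ h0)).congr_deriv ?_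
  rw [etaU]
  field_simp
  norm_num
  ring

/-- polynomial form of the character -/
def charP (τ : ℂ) : ℂ := -(1 / 462) * (etaU τ * (1 / 8640 *
  (12 * (eisF (-504) 5 τ * eisF (-24) 1 τ * eisF 240 3 τ) - 7 * eisF (-504) 5 τ ^ 2
    - 5 * eisF 240 3 τ ^ 3)))

/-- polynomial form of its derivative -/
def charDP (τ : ℂ) : ℂ := -(1 / 462) * (etaU τ * (1 / 103680 *
  (132 * (eisF (-504) 5 τ * eisF 240 3 τ ^ 2) - 55 * (eisF (-24) 1 τ * eisF (-504) 5 τ ^ 2)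
    - 77 * (eisF (-24) 1 τ * eisF 240 3 τ ^ 3))))

lemma charE6_eq {τ : ℂ} (h : 0 < τ.im) : charE6 τ = charP τ := by
  have h0 := eta_ne h
  have h1 := eta_pow h
  have h2 : dedekindEta τ ^ 2 = etaU τ * dedekindEta τ ^ 24 := by
    rw [etaU]; field_simp
  have h3 : E6 τ * DE4 τ / (240 * dedekindEta τ ^ 22) = E6 τ * DE4 τ / 240 * etaU τ := by
    rw [etaU]; field_simp
  have h4 := ramanujan4 ⟨τ, h⟩
  simp only [UpperHalfPlane.coe_mk] at h4
  rw [charE6, h3, h2, h1, E6_eqF h, DE4_eqF h, h4, charP]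
  ring

lemma hasDeriv_charP {τ : ℂ} (h : 0 < τ.im) :
    HasDerivAt charP (2 * (Real.pi : ℂ) * Complex.I * charDP τ) τ := by
  refine (((hasDeriv_U h).fun_mul (((((((hasDeriv_R h).fun_mul (hasDeriv_P h)).fun_mul
    (hasDeriv_Q h)).const_mul 12).fun_sub (((hasDeriv_R h).fun_pow 2).const_mul 7)).fun_sub
    (((hasDeriv_Q h).fun_pow 3).const_mul 5)).const_mul (1 / 8640))).const_mul
    (-(1 / 462))).congr_deriv ?_
  rw [charDP]
  push_cast
  ring

lemma hasDeriv_charDP {τ : ℂ} (h : 0 < τ.im) :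
    HasDerivAt charDP (2 * (Real.pi : ℂ) * Complex.I *
      (1 / 6 * eisF (-24) 1 τ * charDP τ + 143 / 144 * eisF 240 3 τ * charP τ)) τ := by
  refine (((hasDeriv_U h).fun_mul (((((((hasDeriv_R h).fun_mul ((hasDeriv_Q h).fun_pow 2)).const_mul
    132).fun_sub (((hasDeriv_P h).fun_mul ((hasDeriv_R h).fun_pow 2)).const_mul 55)).fun_sub
    (((hasDeriv_P h).fun_mul ((hasDeriv_Q h).fun_pow 3)).const_mul 77)).const_mul
      (1 / 103680)))).const_mul (-(1 / 462))).congr_deriv ?_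
  rw [charDP, charP]
  push_cast
  ring

theorem charE6_holo_and_MLDE :
    DifferentiableOn ℂ charE6 UHP ∧
      ∀ τ ∈ UHP,
        Dop (Dop charE6) τ - (1 / 6 : ℂ) * E2 τ * Dop charE6 τ
          - (143 / 144 : ℂ) * E4 τ * charE6 τ = 0 := by
  have hD : ∀ τ : ℂ, 0 < τ.im → Dop charE6 τ = charDP τ := fun τ h => by
    rw [Dop_congr (fun τ h => charE6_eq h) h, Dop_of_hasDeriv (hasDeriv_charP h)]
  constructor
  · intro τ hτ
    have h : 0 < τ.im := hτ
    exact (hasDeriv_charP h).differentiableAt.differentiableWithinAt.congr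
      (fun z hz => charE6_eq hz) (charE6_eq h)
  · intro τ hτ
    have h : 0 < τ.im := hτ
    rw [Dop_congr hD h, Dop_of_hasDeriv (hasDeriv_charDP h), hD τ h, E2_eqF h, E4_eqF h,
      charE6_eq h]
    ring
end
end

section
/- Let f : ℍ → ℂ be defined by f(τ) = −(1/462)·( E₆(τ)·(DE₄)(τ)/(240·η(τ)²²) − η(τ)² ), where (DE₄)(τ) = 240∑_{n≥1} n·σ₃(n)qⁿ. Then f is of vacuum type with leading exponent 13/12: there exists a holomorphic function g on the open unit disk {z ∈ ℂ : |z| < 1} with g(0) = 1 such that f(τ) = exp(2πiτ·13/12)·g(exp(2πiτ)) for all τ ∈ ℍ. (In particular, the low-order terms of the two summands cancel exactly so that the q-expansion of f begins at q^{13/12} with coefficient 1; 13/12 = (h∨+1)/12 for h∨ = 12, the dual Coxeter number of E₆.) -/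
noncomputable section

open Complex

/-- Power series with coefficients `c`. -/
def pser (c : ℕ → ℂ) (z : ℂ) : ℂ := ∑' n : ℕ, c n * z ^ n

lemma pser_zero (c : ℕ → ℂ) : pser c 0 = c 0 := by
  unfold pser
  rw [tsum_eq_single 0]
  · simp
  · intro n hn
    simp [hn]

lemma summable_bound (k : ℕ) {r : ℝ} (h0 : 0 ≤ r) (h1 : r < 1) :
    Summable (fun n : ℕ => ((n : ℝ) + 2) ^ k * r ^ n) := by
  rcases h0.eq_or_lt with h | h
  · subst h
    refine summable_of_ne_finset_zero (s := {0}) ?_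
    intro n hn
    have : n ≠ 0 := by simpa using hn
    simp [this]
  · have := summable_pow_mul_geometric_of_norm_lt_one (R := ℝ) k (r := r)
      (by rwa [Real.norm_of_nonneg h0])
    have h2 := ((summable_nat_add_iff 2).mpr this).mul_right ((r ^ 2)⁻¹)
    refine h2.congr fun n => ?_
    push_cast
    field_simp
    ring

lemma pser_summable {c : ℕ → ℂ} {k : ℕ} (hc : ∀ n, ‖c n‖ ≤ ((n : ℝ) + 2) ^ k) {z : ℂ}
    (hz : ‖z‖ < 1) : Summable fun n => c n * z ^ n := by
  refine Summable.of_norm_bounded (summable_bound k (norm_nonneg z) hz) fun n => ?_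
  rw [norm_mul, norm_pow]
  gcongr
  exact hc n

lemma pser_diff {c : ℕ → ℂ} {k : ℕ} (hc : ∀ n, ‖c n‖ ≤ ((n : ℝ) + 2) ^ k) :
    DifferentiableOn ℂ (pser c) (Metric.ball 0 1) := by
  intro z hz
  have hz1 : ‖z‖ < 1 := by simpa using hz
  obtain ⟨r, hr, hr1⟩ := exists_between hz1
  have h0 : 0 ≤ r := (norm_nonneg z).trans hr.le
  have hd : DifferentiableOn ℂ (fun w : ℂ => ∑' n : ℕ, c n * w ^ n) (Metric.ball 0 r) := by
    refine differentiableOn_tsum_of_summable_norm (summable_bound k h0 hr1)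
      (fun n => by fun_prop) Metric.isOpen_ball fun n w hw => ?_
    have hw' : ‖w‖ < r := by simpa using hw
    rw [norm_mul, norm_pow]
    gcongr
    exact hc n
  exact (hd.differentiableAt (Metric.isOpen_ball.mem_nhds (by simpa using hr))).differentiableWithinAt

lemma pser_succ {c : ℕ → ℂ} {k : ℕ} (hc : ∀ n, ‖c n‖ ≤ ((n : ℝ) + 2) ^ k) {z : ℂ}
    (hz : ‖z‖ < 1) : pser c z = c 0 + z * pser (fun n => c (n + 1)) z := by
  unfold pser
  rw [(pser_summable hc hz).tsum_eq_zero_add, ← tsum_mul_left]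
  simp only [pow_zero, mul_one]
  congr 1
  refine tsum_congr fun n => ?_
  ring

lemma hasDerivAt_mul_zero {S : ℂ → ℂ} (hS : DifferentiableOn ℂ S (Metric.ball 0 1)) :
    HasDerivAt (fun z => z * S z) (S 0) 0 := by
  have h := (hS.differentiableAt (Metric.isOpen_ball.mem_nhds (by simp : (0 : ℂ) ∈ _))).hasDerivAt
  exact ((hasDerivAt_id (0 : ℂ)).mul h).congr_deriv (by simp)

lemma sigmaC_bound (k n : ℕ) : ‖sigmaC k n‖ ≤ (n : ℝ) ^ (k + 1) := by
  have h : sigmaC k n = ((ArithmeticFunction.sigma k n : ℕ) : ℂ) := by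
    simp [sigmaC, ArithmeticFunction.sigma_apply]
  rw [h, Complex.norm_natCast]
  exact_mod_cast ArithmeticFunction.sigma_le_pow_succ k n

/-- coefficients of `(1 - E₆) / (504 q)` -/
def cA (n : ℕ) : ℂ := sigmaC 5 (n + 1)
/-- coefficients of `DE₄ / (240 q)` -/
def cT (n : ℕ) : ℂ := ((n : ℂ) + 1) * sigmaC 3 (n + 1)

lemma cA_bound (n : ℕ) : ‖cA n‖ ≤ ((n : ℝ) + 2) ^ 6 := by
  refine (sigmaC_bound 5 (n + 1)).trans ?_
  push_cast
  gcongr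
  norm_num

lemma cT_bound' (n : ℕ) : ‖cT n‖ ≤ ((n : ℝ) + 1) ^ 5 := by
  have h := sigmaC_bound 3 (n + 1)
  have h2 : ‖(n : ℂ) + 1‖ = (n : ℝ) + 1 := by
    exact_mod_cast Complex.norm_natCast (n + 1)
  rw [cT, norm_mul, h2, pow_succ']
  push_cast at h
  gcongr

lemma cT_bound (n : ℕ) : ‖cT n‖ ≤ ((n : ℝ) + 2) ^ 5 := by
  refine (cT_bound' n).trans ?_
  gcongr
  norm_num

lemma cT_bound_succ (n : ℕ) : ‖cT (n + 1)‖ ≤ ((n : ℝ) + 2) ^ 5 := by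
  refine (cT_bound' (n + 1)).trans (le_of_eq ?_)
  push_cast
  ring

lemma T_deriv : HasDerivAt (pser cT) 18 0 := by
  have h := (hasDerivAt_mul_zero (pser_diff cT_bound_succ)).const_add (cT 0)
  have h18 : pser (fun n => cT (n + 1)) 0 = 18 := by
    rw [pser_zero]
    have : Nat.divisors 2 = {1, 2} := by decide
    simp [cT, sigmaC, this]
    norm_num
  rw [h18] at h
  refine h.congr_of_eventuallyEq ?_
  filter_upwards [Metric.ball_mem_nhds (0 : ℂ) one_pos] with z hz
  exact pser_succ cT_bound (by simpa using hz)

/-- The Euler product. -/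
def eul (z : ℂ) : ℂ := ∏' n : ℕ, (1 - z ^ (n + 1))

lemma eul_diff : DifferentiableOn ℂ eul (Metric.ball 0 1) :=
  ModularForm.differentiableOn_tprod_one_sub_pow

lemma eul_zero : eul 0 = 1 := by simp [eul]

lemma eul_ne {z : ℂ} (hz : ‖z‖ < 1) : eul z ≠ 0 := by
  have := tprod_one_add_ne_zero_of_summable (f := fun n : ℕ => -z ^ (n + 1)) ?_ ?_
  · simpa [eul, sub_eq_add_neg] using this
  · intro n h
    have h1 : z ^ (n + 1) = 1 := by linear_combination -h
    have h2 : ‖z‖ ^ (n + 1) = 1 := by rw [← norm_pow, h1, norm_one]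
    exact absurd h2 (pow_lt_one₀ (norm_nonneg z) hz (by simp)).ne
  · simpa using (summable_nat_add_iff 1).mpr (summable_geometric_of_lt_one (norm_nonneg _) hz)

lemma logDeriv_factor (n : ℕ) :
    logDeriv (fun z : ℂ => 1 - z ^ (n + 1)) 0 = if n = 0 then -1 else 0 := by
  have h : HasDerivAt (fun z : ℂ => 1 - z ^ (n + 1)) (-(((n + 1 : ℕ) : ℂ) * 0 ^ n)) 0 := by
    simpa using (hasDerivAt_pow (n + 1) (0 : ℂ)).const_sub 1
  rw [logDeriv_apply, h.deriv]
  by_cases hn : n = 0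
  · simp [hn]
  · simp [hn]

lemma eul_deriv : HasDerivAt eul (-1) 0 := by
  have hm : (0 : ℂ) ∈ Metric.ball (0 : ℂ) 1 := by simp
  have h := logDeriv_tprod_eq_tsum (f := fun (n : ℕ) (z : ℂ) => 1 - z ^ (n + 1))
    Metric.isOpen_ball hm (fun i => by simp) (fun i => by fun_prop)
    (by
      simp only [logDeriv_factor]
      exact (hasSum_ite_eq 0 (-1 : ℂ)).summable)
    ModularForm.multipliableLocallyUniformlyOn_one_sub_pow (eul_ne (by simp))
  simp only [logDeriv_factor, tsum_ite_eq] at h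
  change logDeriv eul 0 = -1 at h
  rw [logDeriv_apply, eul_zero, div_one] at h
  rw [← h]
  exact (eul_diff.differentiableAt (Metric.isOpen_ball.mem_nhds hm)).hasDerivAt

/-- `q^(-1/12)` times the bracket in `charE6`, as a function of `q`. -/
def FF (z : ℂ) : ℂ := (1 - 504 * (z * pser cA z)) * pser cT z / eul z ^ 22 - eul z ^ 2

lemma FF_diff : DifferentiableOn ℂ FF (Metric.ball 0 1) := by
  have hA := pser_diff cA_bound
  have hT := pser_diff cT_bound
  have hE := eul_diff
  have hne : ∀ z ∈ Metric.ball (0 : ℂ) 1, eul z ^ 22 ≠ 0 := fun z hz =>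
    pow_ne_zero _ (eul_ne (by simpa using hz))
  unfold FF
  fun_prop (disch := assumption)

lemma FF_zero : FF 0 = 0 := by
  simp [FF, eul_zero, pser_zero, cT, sigmaC]

lemma FF_deriv : HasDerivAt FF (-462) 0 := by
  have hA := ((hasDerivAt_mul_zero (pser_diff cA_bound)).const_mul 504).const_sub 1
  have hP := eul_deriv
  have h := ((hA.mul T_deriv).div (hP.pow 22) (by simp [eul_zero])).sub (hP.pow 2)
  refine h.congr_deriv ?_
  simp [eul_zero, pser_zero, cT, cA, sigmaC]
  norm_num

/-- `charE6` is of vacuum type with leading exponent `13/12`: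
`f(τ) = q^(13/12) (1 + ∑_{n≥1} aₙ qⁿ)` with `g(z) = 1 + ∑ aₙ zⁿ` holomorphic on `|z| < 1`. -/
theorem charE6_vacuum_type :
    ∃ g : ℂ → ℂ, DifferentiableOn ℂ g (Metric.ball (0 : ℂ) 1) ∧ g 0 = 1 ∧
      ∀ τ ∈ UHP,
        charE6 τ = Complex.exp (2 * (Real.pi : ℂ) * Complex.I * τ * (13 / 12)) * g (qc τ) := by
  refine ⟨fun z => -(1 / 462) * dslope FF 0 z, ?_, ?_, ?_⟩
  · exact ((Complex.differentiableOn_dslope (Metric.ball_mem_nhds (0 : ℂ) one_pos)).mpr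
      FF_diff).const_mul _
  · simp only [dslope_same, FF_deriv.deriv]
    norm_num
  · intro τ hτ
    have hτ' : 0 < τ.im := hτ
    have hq0 : qc τ ≠ 0 := Complex.exp_ne_zero _
    have hq1 : ‖qc τ‖ < 1 := by
      have := UpperHalfPlane.norm_exp_two_pi_I_lt_one ⟨τ, hτ'⟩
      simpa [qc] using this
    have hs : dslope FF 0 (qc τ) = FF (qc τ) / qc τ := by
      rw [dslope_of_ne _ hq0, slope_def_field, FF_zero]
      simp
    have hA : E6 τ = 1 - 504 * (qc τ * pser cA (qc τ)) := by
      unfold E6 pser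
      rw [← tsum_mul_left (a := qc τ)]
      refine congrArg (fun x => 1 - 504 * x) ?_
      refine tsum_congr fun n => ?_
      simp only [cA]
      ring
    have hT : DE4 τ = 240 * (qc τ * pser cT (qc τ)) := by
      unfold DE4 pser
      rw [← tsum_mul_left (a := qc τ)]
      refine congrArg (fun x => 240 * x) ?_
      refine tsum_congr fun n => ?_
      simp only [cT]
      ring
    set e : ℂ := Complex.exp (2 * (Real.pi : ℂ) * Complex.I * τ / 24) with he
    have he0 : e ≠ 0 := Complex.exp_ne_zero _
    have hη : dedekindEta τ = e * eul (qc τ) := rfl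
    have hqe : qc τ = e ^ 24 := by
      rw [he, ← Complex.exp_nat_mul, qc]
      congr 1
      push_cast
      ring
    have h13 : Complex.exp (2 * (Real.pi : ℂ) * Complex.I * τ * (13 / 12)) = e ^ 26 := by
      rw [he, ← Complex.exp_nat_mul]
      congr 1
      push_cast
      ring
    have hP := eul_ne hq1
    simp only [hs]
    rw [h13, charE6, hA, hT, hη, FF]
    generalize eul (qc τ) = P at *
    generalize pser cA (qc τ) = A at *
    generalize pser cT (qc τ) = T at *
    rw [hqe]
    field_simp
end
end
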